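/- arXiv:1810.10660 — 2 statements merged into one kernel-verified Lean document; each statement's English description precedes it below -/
import Mathlib

section
/- For every fixed S > 0 (so that h(S) > 0), the partial derivative of V with respect to β satisfies the identity ∂V/∂β (β,S) = ψ(β,S)·a(β)·log R(β,S) for all β ≥ 0, where ψ(β,S) = h(S)/(R(β,S)·log R(β,S)) − (ε−1)·η_β/(c + η_β·β). In particular, since a(β)·log R(β,S) > 0, the sign of ∂V/∂β equals the sign of ψ(β,S). -/
/-- Cache hit probability `h(S) = log(S+1)/log Σ`. -/
noncomputable def hitProb (Sig S : ℝ) : ℝ := Real.log (S + 1) / Real.log Sig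

/-- Average network capacity `R(β,S) = (δr + β)·h(S) + 1`. -/
noncomputable def capR (Sig dr β S : ℝ) : ℝ := (dr + β) * hitProb Sig S + 1

/-- Coefficient `a(β) = ((ε−1)^(ε−1)/ε^ε)·A/(c + η_β·β)^(ε−1)`. -/
noncomputable def coefA (A ε c ηβ β : ℝ) : ℝ :=
  (ε - 1) ^ (ε - 1) / ε ^ ε * A / (c + ηβ * β) ^ (ε - 1)

/-- Operational profit `V(β,S) = a(β)·log R(β,S) − (c_S + η_S)·S − f`. -/
noncomputable def profitV (Sig dr A ε c ηβ cS ηS f β S : ℝ) : ℝ :=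
  coefA A ε c ηβ β * Real.log (capR Sig dr β S) - (cS + ηS) * S - f

/-- `ψ(β,S) = h(S)/(R(β,S)·log R(β,S)) − (ε−1)·η_β/(c + η_β·β)`. -/
noncomputable def psiFn (Sig dr ε c ηβ β S : ℝ) : ℝ :=
  hitProb Sig S / (capR Sig dr β S * Real.log (capR Sig dr β S))
    - (ε - 1) * ηβ / (c + ηβ * β)

theorem hitProb_pos {Sig S : ℝ} (hSig : 1 < Sig) (hS : 0 < S) : 0 < hitProb Sig S :=
  div_pos (Real.log_pos (by linarith)) (Real.log_pos hSig)

theorem one_lt_capR {Sig dr β S : ℝ} (hSig : 1 < Sig) (hdr : 0 < dr) (hβ : 0 ≤ β)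
    (hS : 0 < S) : 1 < capR Sig dr β S := by
  have := mul_pos (add_pos_of_pos_of_nonneg hdr hβ) (hitProb_pos hSig hS)
  unfold capR
  linarith

theorem coefA_pos {A ε c ηβ β : ℝ} (hA : 0 < A) (hε : 1 < ε) (h : 0 < c + ηβ * β) :
    0 < coefA A ε c ηβ β := by
  have h₁ : 0 < ε - 1 := by linarith
  have h₀ : 0 < ε := by linarith
  unfold coefA
  positivity

theorem hasDerivAt_capR (Sig dr β S : ℝ) :
    HasDerivAt (fun b => capR Sig dr b S) (hitProb Sig S) β := by
  simpa [capR] using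
    (((hasDerivAt_id β).const_add dr).mul_const (hitProb Sig S)).add_const 1

theorem hasDerivAt_coefA (A ε ηβ : ℝ) {c β : ℝ} (h : 0 < c + ηβ * β) :
    HasDerivAt (fun b => coefA A ε c ηβ b)
      (-((ε - 1) * ηβ / (c + ηβ * β)) * coefA A ε c ηβ β) β := by
  have hlin : HasDerivAt (fun b => c + ηβ * b) ηβ β := by
    simpa using ((hasDerivAt_id β).const_mul ηβ).const_add c
  have hpow : (c + ηβ * β) ^ (ε - 1) ≠ 0 := (Real.rpow_pos_of_pos h _).ne'
  have hd := (hasDerivAt_const β ((ε - 1) ^ (ε - 1) / ε ^ ε * A)).div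
    (hlin.rpow_const (p := ε - 1) (Or.inl h.ne')) hpow
  refine hd.congr_deriv ?_
  rw [Real.rpow_sub_one h.ne' (ε - 1), coefA]
  generalize (ε - 1) ^ (ε - 1) / ε ^ ε * A = K
  have h0 := h.ne'
  field_simp
  ring

/-- For every fixed `S > 0` (so that `h(S) > 0`), the partial derivative
of `V` with respect to `β` satisfies `∂V/∂β(β,S) = ψ(β,S)·a(β)·log R(β,S)` for all
`β ≥ 0`.  In particular, `a(β)·log R(β,S) > 0`, so the sign of `∂V/∂β` equals the
sign of `ψ(β,S)`. -/
theorem capacity_derivative (Sig dr A ε c ηβ cS ηS f : ℝ)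
    (hSig : 1 < Sig) (hdr : 0 < dr) (hA : 0 < A) (hε : 1 < ε) (hc : 0 < c)
    (hηβ : 0 < ηβ) (hcS : 0 ≤ cS) (hηS : 0 ≤ ηS) (hcη : 0 < cS + ηS)
    (S : ℝ) (hS : 0 < S) :
    (∀ β, 0 ≤ β → HasDerivAt (fun b => profitV Sig dr A ε c ηβ cS ηS f b S)
      (psiFn Sig dr ε c ηβ β S * (coefA A ε c ηβ β * Real.log (capR Sig dr β S))) β) ∧
    (∀ β, 0 ≤ β → 0 < coefA A ε c ηβ β * Real.log (capR Sig dr β S)) := by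
  have hlin : ∀ β, 0 ≤ β → 0 < c + ηβ * β := fun β hβ => by positivity
  refine ⟨fun β hβ => ?_, fun β hβ =>
    mul_pos (coefA_pos hA hε (hlin β hβ)) (Real.log_pos (one_lt_capR hSig hdr hβ hS))⟩
  have hR := one_lt_capR hSig hdr hβ hS
  have hR0 : capR Sig dr β S ≠ 0 := by linarith
  have hL0 : Real.log (capR Sig dr β S) ≠ 0 := (Real.log_pos hR).ne'
  have h0 := (hlin β hβ).ne'
  have hd := (((hasDerivAt_coefA A ε ηβ (hlin β hβ)).mul
    ((hasDerivAt_capR Sig dr β S).log hR0)).sub_const ((cS + ηS) * S)).sub_const f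
  refine hd.congr_deriv ?_
  unfold psiFn
  field_simp
  ring
end

section
/- (Proposition 5, ISP payoff.) The Shapley value payoff of the ISP (player K+1) in the (K+1)-player game with characteristic function v equals x_{K+1} = (1/2)·Σ_{k=1}^{K} v_k − (K/(K+1))·F. -/
/-- Characteristic function of the game: players are `1,…,K+1` with the ISP
indexed `K+1`.  `charv K vk F C = (Σ_{k ∈ C, k ≤ K} vk k) − F` if `K+1 ∈ C` and
`C` contains at least one CP index `k ≤ K`, and `charv K vk F C = 0` otherwise. -/
noncomputable def charv (K : ℕ) (vk : ℕ → ℝ) (F : ℝ) (C : Finset ℕ) : ℝ :=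
  if (K + 1) ∈ C ∧ ∃ k ∈ C, k ≤ K then
    (∑ k ∈ C.filter (fun k => k ≤ K), vk k) - F
  else 0

/-- Shapley value of player `i` in the `(K+1)`-player game on `N = {1,…,K+1}`:
`x_i = Σ_{S ⊆ N∖{i}} (|S|!·(n−1−|S|)!/n!)·(v(S ∪ {i}) − v(S))` with `n = K+1`. -/
noncomputable def shapley (K : ℕ) (vk : ℕ → ℝ) (F : ℝ) (i : ℕ) : ℝ :=
  ∑ S ∈ ((Finset.Icc 1 (K + 1)).erase i).powerset,
    (((S.card.factorial * (K - S.card).factorial : ℕ) : ℝ) /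
        (((K + 1).factorial : ℕ) : ℝ)) *
      (charv K vk F (insert i S) - charv K vk F S)


open Finset in
/-- The Shapley weights `|S|! (|A| - |S|)! / (|A| + 1)!` of the subsets `S` of `A` sum to `1`. -/
theorem sum_powerset_shapley_weight {α : Type*} (A : Finset α) :
    ∑ S ∈ A.powerset, (((#S).factorial * (#A - #S).factorial : ℕ) : ℝ) /
      (((#A + 1).factorial : ℕ) : ℝ) = 1 := by
  rw [sum_powerset_apply_card
    (fun j => ((j.factorial * (#A - j).factorial : ℕ) : ℝ) / (((#A + 1).factorial : ℕ) : ℝ))]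
  have h : ∀ j ∈ range (#A + 1), (#A).choose j •
      (((j.factorial * (#A - j).factorial : ℕ) : ℝ) / (((#A + 1).factorial : ℕ) : ℝ)) =
        1 / ((#A : ℝ) + 1) := by
    intro j hj
    have hf : ((#A).factorial : ℝ) ≠ 0 := by positivity
    rw [nsmul_eq_mul, ← mul_div_assoc, ← Nat.cast_mul, ← mul_assoc,
      Nat.choose_mul_factorial_mul_factorial (Nat.lt_succ_iff.mp (mem_range.mp hj)),
      Nat.factorial_succ]
    push_cast
    field_simp
  rw [sum_congr rfl h, sum_const, card_range, nsmul_eq_mul]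
  push_cast
  field_simp

open Finset in
/-- If `w` is invariant under complementation in `A`, then the `w`-weighted sum of the additive
set function with density `f` is half of what it would be with every subset replaced by `A`. -/
theorem two_mul_sum_powerset_mul_sum {α : Type*} [DecidableEq α] (A : Finset α)
    (w : Finset α → ℝ) (hw : ∀ S ⊆ A, w (A \ S) = w S) (f : α → ℝ) :
    2 * ∑ S ∈ A.powerset, w S * ∑ k ∈ S, f k = (∑ S ∈ A.powerset, w S) * ∑ k ∈ A, f k := by
  have h : ∑ S ∈ A.powerset, w S * ∑ k ∈ S, f k =
      ∑ S ∈ A.powerset, w S * ∑ k ∈ A \ S, f k := by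
    refine sum_nbij' (fun S => A \ S) (fun S => A \ S) ?_ ?_ ?_ ?_ ?_
    · exact fun S _ => mem_powerset.mpr sdiff_subset
    · exact fun S _ => mem_powerset.mpr sdiff_subset
    · exact fun S hS => Finset.sdiff_sdiff_eq_self (mem_powerset.mp hS)
    · exact fun S hS => Finset.sdiff_sdiff_eq_self (mem_powerset.mp hS)
    · intro S hS
      rw [hw S (mem_powerset.mp hS), Finset.sdiff_sdiff_eq_self (mem_powerset.mp hS)]
  rw [two_mul]
  nth_rewrite 1 [h]
  rw [← sum_add_distrib, sum_mul]
  refine sum_congr rfl fun S hS => ?_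
  rw [← mul_add, sum_sdiff (mem_powerset.mp hS)]

open Finset in
/-- The marginal contribution of the ISP to a set of content providers. -/
theorem charv_insert_sub (K : ℕ) (vk : ℕ → ℝ) (F : ℝ) {S : Finset ℕ} (hS : S ⊆ Icc 1 K) :
    charv K vk F (insert (K + 1) S) - charv K vk F S =
      ∑ k ∈ S, vk k - F + if S = ∅ then F else 0 := by
  have hle : ∀ k ∈ S, k ≤ K := fun k hk => (mem_Icc.mp (hS hk)).2
  have hnot : K + 1 ∉ S := fun h => absurd (hle _ h) (by omega)
  have hfilter : (insert (K + 1) S).filter (fun k => k ≤ K) = S := by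
    rw [filter_insert, if_neg (by omega), filter_true_of_mem hle]
  rcases S.eq_empty_or_nonempty with rfl | hne
  · simp [charv]
  · obtain ⟨k, hk⟩ := hne
    have hex : K + 1 ∈ insert (K + 1) S ∧ ∃ k ∈ insert (K + 1) S, k ≤ K :=
      ⟨mem_insert_self _ _, k, mem_insert_of_mem hk, hle k hk⟩
    rw [charv, charv, if_pos hex, if_neg (fun h => hnot h.1), hfilter,
      if_neg (ne_empty_of_mem hk)]
    ring

/-- Proposition 5, ISP payoff: the Shapley value payoff of the ISP
(player `K+1`) equals `x_{K+1} = (1/2)·Σ_{k=1}^{K} v_k − (K/(K+1))·F`. -/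
theorem shapley_ISP (K : ℕ) (hK : 1 ≤ K) (vk : ℕ → ℝ) (F : ℝ) :
    shapley K vk F (K + 1) =
      (1 / 2) * (∑ k ∈ Finset.Icc 1 K, vk k) - ((K : ℝ) / ((K : ℝ) + 1)) * F := by
  have hA : (Finset.Icc 1 (K + 1)).erase (K + 1) = Finset.Icc 1 K := by
    ext k
    simp only [Finset.mem_erase, Finset.mem_Icc]
    omega
  have hcard : (Finset.Icc 1 K).card = K := by simp
  set w : Finset ℕ → ℝ := fun S =>
    ((S.card.factorial * (K - S.card).factorial : ℕ) : ℝ) / (((K + 1).factorial : ℕ) : ℝ) with hw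
  have hsum : ∑ S ∈ (Finset.Icc 1 K).powerset, w S = 1 := by
    simpa only [hcard] using sum_powerset_shapley_weight (Finset.Icc 1 K)
  have hcompl : ∀ S ⊆ Finset.Icc 1 K, w (Finset.Icc 1 K \ S) = w S := by
    intro S hS
    have hle : S.card ≤ K := hcard ▸ Finset.card_le_card hS
    simp only [hw]
    rw [Finset.card_sdiff_of_subset hS, hcard, Nat.sub_sub_self hle, mul_comm]
  have hhalf := two_mul_sum_powerset_mul_sum (Finset.Icc 1 K) w hcompl vk
  have hempty : w ∅ = 1 / ((K : ℝ) + 1) := by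
    have hf : (K.factorial : ℝ) ≠ 0 := by positivity
    simp only [hw, Finset.card_empty, Nat.factorial_zero, Nat.sub_zero, Nat.factorial_succ]
    push_cast
    field_simp
  have hshapley : shapley K vk F (K + 1) =
      ∑ S ∈ (Finset.Icc 1 K).powerset, w S * ∑ k ∈ S, vk k - F + w ∅ * F := by
    rw [shapley, hA, Finset.sum_congr rfl fun S hS => by
      rw [charv_insert_sub K vk F (Finset.mem_powerset.mp hS)]]
    change ∑ S ∈ (Finset.Icc 1 K).powerset, w S * _ = _
    simp only [mul_add, mul_sub, Finset.sum_add_distrib, Finset.sum_sub_distrib, mul_ite, mul_zero,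
      Finset.sum_ite_eq', Finset.empty_mem_powerset, if_true, ← Finset.sum_mul, hsum, one_mul]
  rw [hsum, one_mul] at hhalf
  rw [hshapley, hempty, ← hhalf]
  field_simp
  ring
end
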